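/- arXiv:1510.05293 — 3 statements merged into one kernel-verified Lean document; each statement's English description precedes it below -/
import Mathlib

section
/- Let H be a real separable Hilbert space, let N be a norm on H such that N(x) ≤ C|x| for some constant C > 0 and all x ∈ H, and suppose N is a measurable norm on H, i.e.: for every ε > 0 and every h > 0 there exists a finite-dimensional subspace F of H such that for every finite-dimensional subspace E of H orthogonal to F one has μ_{E,h}({x ∈ E : N(x) > ε}) < ε. Then for every closed subspace H₁ of H, the restriction of N to H₁ is a measurable norm on H₁ (with the same definition, using finite-dimensional subspaces of H₁ and orthogonality within H₁). -/
open MeasureTheory ProbabilityTheory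
open scoped RealInnerProductSpace

noncomputable section

/-- `N` is a measurable norm on the real inner product space `V` (Gross):  for every
`ε > 0` and every `h > 0` there is a finite-dimensional subspace `F` such that for every
finite-dimensional subspace `E` orthogonal to `F`, the centered Gaussian measure of
variance `h` on `E` (realized as the pushforward of the product Gaussian on `ℝⁿ` under any
linear isometry `ℝⁿ ≃ E`, `n = dim E`) gives mass `< ε` to `{x ∈ E : N(x) > ε}`. -/
def IsMeasurableNorm {V : Type*} [NormedAddCommGroup V] [InnerProductSpace ℝ V]
    (N : V → ℝ) : Prop :=
  ∀ ε : ℝ, 0 < ε → ∀ h : ℝ, 0 < h →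
    ∃ F : Submodule ℝ V, FiniteDimensional ℝ F ∧
      ∀ E : Submodule ℝ V, FiniteDimensional ℝ E →
        (∀ x ∈ E, ∀ y ∈ F, ⟪x, y⟫ = 0) →
        ∀ (n : ℕ) (φ : EuclideanSpace ℝ (Fin n) →ₗᵢ[ℝ] V),
          Set.range φ = (E : Set V) →
          (Measure.pi fun _ : Fin n => gaussianReal 0 h.toNNReal)
              {v : Fin n → ℝ | ε < N (φ ((WithLp.equiv 2 (Fin n → ℝ)).symm v))}
            < ENNReal.ofReal ε

/-- A measurable norm on a real separable Hilbert space restricts to a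
measurable norm on every closed subspace. -/
theorem stmt_1 {H : Type*} [NormedAddCommGroup H] [InnerProductSpace ℝ H]
    [CompleteSpace H] [TopologicalSpace.SeparableSpace H]
    (N : H → ℝ) (C : ℝ) (hC : 0 < C) (hNle : ∀ x, N x ≤ C * ‖x‖)
    (hN0 : ∀ x, N x = 0 ↔ x = 0)
    (hNadd : ∀ x y, N (x + y) ≤ N x + N y)
    (hNsmul : ∀ (a : ℝ) (x : H), N (a • x) = |a| * N x)
    (hmeas : IsMeasurableNorm N)
    (H₁ : Submodule ℝ H) (hcl : IsClosed (H₁ : Set H)) :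
    IsMeasurableNorm (fun x : H₁ => N x) := by
  intro ε hε h hh
  have : CompleteSpace H₁ := hcl.completeSpace_coe
  obtain ⟨F, hF, hFE⟩ := hmeas ε hε h hh
  refine ⟨F.map H₁.orthogonalProjectionOnto.toLinearMap, inferInstance, ?_⟩
  intro E hE hort n φ hφ
  refine hFE (E.map H₁.subtype) inferInstance ?_ n (H₁.subtypeₗᵢ.comp φ) ?_
  · rintro _ ⟨x, hx, rfl⟩ y hy
    rw [← hort x hx _ (Submodule.mem_map_of_mem hy)]
    exact (Submodule.inner_orthogonalProjectionOnto_eq_of_mem_left x y).symm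
  · rw [LinearIsometry.coe_comp, Set.range_comp, hφ]
    rfl
end
end

section
/- Let χ be a real Schwartz function on ℝ vanishing on a neighborhood of 0, and define ρ : ℝ³ → ℝ by ρ(z) = (2π)^{-3} ∫_{ℝ³} |χ(|k|)|² cos(k·z) dk. Then for all x, y ∈ ℝ³: (2π)^{-3} ∫_{ℝ³} χ(|k|)² |k|^{-2} [cos(k·x) sin(k·y) − sin(k·x) cos(k·y)] ((k×(k×e₁))·(k×e₂)) dk = −(∂ρ/∂z₃)(y−x), where (e₁,e₂,e₃) is the canonical basis of ℝ³ and × is the cross product. (The left-hand side is the Poisson bracket {E₁(x,·), B₂(y,·)} of the electric and magnetic field symbols, so this identity yields the commutation relation [E₁(x), B₂(y)] = i h (∂₃ρ)(y−x).) -/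
open MeasureTheory Real
open scoped RealInnerProductSpace

noncomputable section

abbrev K3 := EuclideanSpace ℝ (Fin 3)

/-- The cross product on `ℝ³` (Euclidean coordinates). -/
def cross3 (a b : K3) : K3 :=
  (WithLp.equiv 2 (Fin 3 → ℝ)).symm
    ![a 1 * b 2 - a 2 * b 1, a 2 * b 0 - a 0 * b 2, a 0 * b 1 - a 1 * b 0]

/-- The canonical basis vectors of `ℝ³`. -/
def e3 (j : Fin 3) : K3 := EuclideanSpace.single j 1

/-- `(k × (k × e₁)) · (k × e₂) = |k|² k₃`. -/
theorem inner_cross3_cross3_e3 (k : K3) :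
    ⟪cross3 k (cross3 k (e3 0)), cross3 k (e3 1)⟫ = ‖k‖ ^ 2 * k 2 := by
  rw [EuclideanSpace.real_norm_sq_eq]
  simp [cross3, e3, PiLp.inner_apply, Fin.sum_univ_three]
  ring

/-- The square of a radial Schwartz profile, weighted by `1 + ‖k‖`, is integrable on `ℝ³`. -/
theorem integrable_sq_mul_one_add_norm (χ : SchwartzMap ℝ ℝ) :
    Integrable (fun k : K3 => (χ ‖k‖) ^ 2 * (1 + ‖k‖)) := by
  have hdecay (n : ℕ) : ∃ C : ℝ, ∀ k : K3, (1 + ‖k‖) ^ n * |χ ‖k‖| ≤ C := by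
    have h := SchwartzMap.one_add_le_sup_seminorm_apply (𝕜 := ℝ) (m := (n, 0)) le_rfl le_rfl χ
    simp only [norm_iteratedFDeriv_zero] at h
    exact ⟨_, fun k => by simpa only [norm_norm, ← Real.norm_eq_abs] using h ‖k‖⟩
  obtain ⟨A, hA⟩ := hdecay 0
  obtain ⟨C, hC⟩ := hdecay 5
  have hint : Integrable (fun k : K3 => (1 + ‖k‖) ^ (-4 : ℝ)) :=
    integrable_one_add_norm (by simp; norm_num)
  refine (hint.const_mul (A * C)).mono' (by fun_prop) (.of_forall fun k => ?_)
  have hpos : 0 < 1 + ‖k‖ := by positivity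
  have hmul := mul_le_mul (hA k) (hC k) (by positivity)
    ((by positivity : (0 : ℝ) ≤ _).trans (hA k))
  rw [Real.norm_of_nonneg (by positivity), Real.rpow_neg hpos.le, ← div_eq_mul_inv,
    le_div_iff₀ (by positivity), show (4 : ℝ) = (4 : ℕ) by norm_num, Real.rpow_natCast]
  calc (χ ‖k‖) ^ 2 * (1 + ‖k‖) * (1 + ‖k‖) ^ 4
      = (1 + ‖k‖) ^ 0 * |χ ‖k‖| * ((1 + ‖k‖) ^ 5 * |χ ‖k‖|) := by rw [← sq_abs]; ring
    _ ≤ A * C := hmul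

/-- Differentiation under the integral sign for the cosine transform of `χ(|k|)²`. -/
theorem hasFDerivAt_integral_sq_mul_cos (χ : SchwartzMap ℝ ℝ) (z v : K3) :
    HasFDerivAt (fun z : K3 => ∫ k : K3, (χ ‖k‖) ^ 2 * Real.cos ⟪k, z⟫)
      (∫ k : K3, (-((χ ‖k‖) ^ 2 * Real.sin ⟪k, z⟫)) • innerSL ℝ k) z ∧
    (∫ k : K3, (-((χ ‖k‖) ^ 2 * Real.sin ⟪k, z⟫)) • innerSL ℝ k) v
      = -∫ k : K3, (χ ‖k‖) ^ 2 * Real.sin ⟪k, z⟫ * ⟪k, v⟫ := by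
  have hbound := integrable_sq_mul_one_add_norm χ
  have hmeas (z : K3) : AEStronglyMeasurable
      (fun k : K3 => (-((χ ‖k‖) ^ 2 * Real.sin ⟪k, z⟫)) • innerSL ℝ k) volume :=
    Continuous.aestronglyMeasurable (by fun_prop)
  have hle (k z : K3) : ‖(-((χ ‖k‖) ^ 2 * Real.sin ⟪k, z⟫)) • innerSL ℝ k‖
      ≤ (χ ‖k‖) ^ 2 * (1 + ‖k‖) := by
    rw [norm_smul, innerSL_apply_norm, norm_neg, norm_mul, Real.norm_of_nonneg (sq_nonneg _),
      mul_assoc]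
    gcongr
    nlinarith [Real.abs_sin_le_one ⟪k, z⟫, norm_nonneg k, Real.norm_eq_abs (Real.sin ⟪k, z⟫)]
  constructor
  · refine hasFDerivAt_integral_of_dominated_of_fderiv_le (s := Set.univ)
      (bound := fun k : K3 => (χ ‖k‖) ^ 2 * (1 + ‖k‖)) Filter.univ_mem
      (.of_forall fun z => Continuous.aestronglyMeasurable (by fun_prop))
      (hbound.mono' (Continuous.aestronglyMeasurable (by fun_prop)) (.of_forall fun k => ?_))
      (hmeas z) (.of_forall fun k z _ => hle k z) hbound (.of_forall fun k z _ => ?_)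
    · rw [norm_mul, Real.norm_of_nonneg (sq_nonneg _)]
      gcongr
      exact (Real.abs_cos_le_one _).trans (by simp)
    · rw [← mul_neg, mul_smul]
      exact ((innerSL ℝ k).hasFDerivAt (x := z)).cos.const_mul ((χ ‖k‖) ^ 2)
  · rw [ContinuousLinearMap.integral_apply (hbound.mono' (hmeas z) (.of_forall fun k => hle k z)),
      ← integral_neg]
    simp

/-- The Poisson bracket of the electric and magnetic field symbols:
with `ρ(z) = (2π)⁻³ ∫ χ(|k|)² cos(k·z) dk`, for all `x, y ∈ ℝ³`,
`(2π)⁻³ ∫ χ(|k|)²|k|⁻² (cos(k·x)sin(k·y) − sin(k·x)cos(k·y)) (k×(k×e₁))·(k×e₂) dk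
  = −(∂ρ/∂z₃)(y−x)`. -/
theorem stmt_9 (χ : SchwartzMap ℝ ℝ) (hχ : ∀ᶠ s in nhds (0 : ℝ), χ s = 0)
    (ρ : K3 → ℝ)
    (hρ : ∀ z : K3, ρ z = (2 * π) ^ (-3 : ℤ) * ∫ k : K3, (χ ‖k‖) ^ 2 * Real.cos ⟪k, z⟫)
    (x y : K3) :
    (2 * π) ^ (-3 : ℤ) * ∫ k : K3, (χ ‖k‖) ^ 2 * (‖k‖ ^ 2)⁻¹
        * (Real.cos ⟪k, x⟫ * Real.sin ⟪k, y⟫ - Real.sin ⟪k, x⟫ * Real.cos ⟪k, y⟫)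
        * ⟪cross3 k (cross3 k (e3 0)), cross3 k (e3 1)⟫
      = -(fderiv ℝ ρ (y - x) (e3 2)) := by
  obtain ⟨hderiv, happly⟩ := hasFDerivAt_integral_sq_mul_cos χ (y - x) (e3 2)
  rw [funext hρ, (hderiv.const_mul _).fderiv, smul_apply, happly, smul_eq_mul, mul_neg, neg_neg]
  congr 2 with k
  rw [inner_cross3_cross3_e3, inner_sub_right, Real.sin_sub,
    show ⟪k, e3 2⟫ = k 2 by simp [e3, EuclideanSpace.inner_single_right]]
  rcases eq_or_ne k 0 with rfl | hk
  · simp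
  · have := norm_ne_zero_iff.mpr hk
    field_simp
end
end

section
/- Let 𝓦 = L²(ℝ³,ℂ³) × L²(ℝ³,ℂ³) (a complex Hilbert space) and let 𝓥 ⊂ 𝓦 be the real-linear subspace of pairs of almost-everywhere real-valued fields, so that every Z ∈ 𝓦 is uniquely Z = X + iY with X = Re Z, Y = Im Z ∈ 𝓥 (real and imaginary parts taken pointwise). Let M, K ≥ 0 and let F : 𝓥 → ℂ be a smooth function (with respect to the real Hilbert space structure of 𝓥) such that for every m ∈ ℕ and every X ∈ 𝓥 the m-th Fréchet derivative satisfies |d^m F(X)(X₁,…,X_m)| ≤ M ∏_{j=1}^{m} K|X_j| for all X₁,…,X_m ∈ 𝓥. Then there exists a function 𝓕 : 𝓦 → ℂ which is analytic on 𝓦 (as a function on the complex Banach space 𝓦), coincides with F on 𝓥, and satisfies the exponential bound |𝓕(X+iY)| ≤ M e^{K|Y|} for all X, Y ∈ 𝓥. -/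
open MeasureTheory

noncomputable section

/-- The complex Hilbert space `L²(ℝ³,ℂ³)`. -/
abbrev WC := Lp (EuclideanSpace ℂ (Fin 3)) 2 (volume : Measure K3)

/-- The real-linear subspace `𝓥` of `𝓦 = L²(ℝ³,ℂ³) × L²(ℝ³,ℂ³)` consisting of pairs of
almost-everywhere real-valued fields. -/
def Vsub : Submodule ℝ (WC × WC) where
  carrier := {Z | (∀ᵐ k : K3, ∀ i, (Z.1 k i).im = 0) ∧ (∀ᵐ k : K3, ∀ i, (Z.2 k i).im = 0)}
  add_mem' := by
    rintro Z W ⟨hZ1, hZ2⟩ ⟨hW1, hW2⟩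
    constructor
    · filter_upwards [Lp.coeFn_add Z.1 W.1, hZ1, hW1] with k hk h1 h2 i
      rw [show (Z + W).1 = Z.1 + W.1 from rfl, hk]; simp [h1 i, h2 i]
    · filter_upwards [Lp.coeFn_add Z.2 W.2, hZ2, hW2] with k hk h1 h2 i
      rw [show (Z + W).2 = Z.2 + W.2 from rfl, hk]; simp [h1 i, h2 i]
  zero_mem' := by
    constructor
    · filter_upwards [Lp.coeFn_zero (EuclideanSpace ℂ (Fin 3)) 2 (volume : Measure K3)]
        with k hk i
      rw [(show ((0 : WC × WC).1 : K3 →ₘ[volume] EuclideanSpace ℂ (Fin 3)) = (0 : WC) from rfl)]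
      rw [hk]; simp
    · filter_upwards [Lp.coeFn_zero (EuclideanSpace ℂ (Fin 3)) 2 (volume : Measure K3)]
        with k hk i
      rw [(show ((0 : WC × WC).2 : K3 →ₘ[volume] EuclideanSpace ℂ (Fin 3)) = (0 : WC) from rfl)]
      rw [hk]; simp
  smul_mem' := by
    rintro c Z ⟨hZ1, hZ2⟩
    constructor
    · filter_upwards [Lp.coeFn_smul c Z.1, hZ1] with k hk h1 i
      rw [show (c • Z).1 = c • Z.1 from rfl, hk]; simp [h1 i]
    · filter_upwards [Lp.coeFn_smul c Z.2, hZ2] with k hk h1 i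
      rw [show (c • Z).2 = c • Z.2 from rfl, hk]; simp [h1 i]

open scoped Nat
open Filter Topology

section Taylor

variable {V G : Type*} [NormedAddCommGroup V] [NormedSpace ℝ V]
  [NormedAddCommGroup G] [NormedSpace ℝ G] {F : V → G}

theorem iteratedDeriv_comp_add_smul (hF : ContDiff ℝ (⊤ : ℕ∞) F) (X Y : V) (m : ℕ) :
    iteratedDeriv m (fun t : ℝ => F (X + t • Y)) =
      fun t : ℝ => iteratedFDeriv ℝ m F (X + t • Y) (fun _ => Y) := by
  induction m with
  | zero => ext t; simp
  | succ m ih =>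
    ext t
    rw [iteratedDeriv_succ, ih, iteratedFDeriv_succ_apply_left]
    have hd : HasFDerivAt (iteratedFDeriv ℝ m F) (fderiv ℝ (iteratedFDeriv ℝ m F) (X + t • Y))
        (X + t • Y) :=
      ((hF.differentiable_iteratedFDeriv (by exact_mod_cast ENat.natCast_lt_top m)) _).hasFDerivAt
    have hl : HasDerivAt (fun t : ℝ => X + t • Y) Y t := by
      simpa using ((hasDerivAt_id t).smul_const Y).const_add X
    have h := ((ContinuousMultilinearMap.apply ℝ (fun _ : Fin m => V) G
      (fun _ => Y)).hasFDerivAt.comp_hasDerivAt t (hd.comp_hasDerivAt t hl))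
    exact h.deriv

theorem hasSum_taylor_of_iteratedFDeriv_le [CompleteSpace G] {M K : ℝ}
    (hF : ContDiff ℝ (⊤ : ℕ∞) F)
    (hbd : ∀ (m : ℕ) (X : V) (v : Fin m → V),
      ‖iteratedFDeriv ℝ m F X v‖ ≤ M * ∏ j, (K * ‖v j‖)) (X Y : V) :
    HasSum (fun m : ℕ => (m ! : ℝ)⁻¹ • iteratedFDeriv ℝ m F X (fun _ => Y)) (F (X + Y)) := by
  have hle : ∀ m Z, ‖iteratedFDeriv ℝ m F Z (fun _ => Y)‖ ≤ M * (K * ‖Y‖) ^ m := by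
    intro m Z
    simpa using hbd m Z (fun _ => Y)
  have hsum : Summable (fun m : ℕ => (m ! : ℝ)⁻¹ • iteratedFDeriv ℝ m F X (fun _ => Y)) := by
    refine Summable.of_norm_bounded ((Real.summable_pow_div_factorial (K * ‖Y‖)).mul_left M) ?_
    intro m
    rw [norm_smul, norm_inv, Real.norm_natCast]
    calc (m ! : ℝ)⁻¹ * _ ≤ (m ! : ℝ)⁻¹ * (M * (K * ‖Y‖) ^ m) := by gcongr; exact hle m X
      _ = _ := by ring
  rw [hsum.hasSum_iff_tendsto_nat, ← tendsto_add_atTop_iff_nat 1, tendsto_iff_norm_sub_tendsto_zero]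
  have hlim : Tendsto (fun n : ℕ => M * (K * ‖Y‖) * ((K * ‖Y‖) ^ n / n !)) atTop (𝓝 0) := by
    simpa using (FloorSemiring.tendsto_pow_div_factorial_atTop (K * ‖Y‖)).const_mul
      (M * (K * ‖Y‖))
  refine squeeze_zero (fun _ => norm_nonneg _) (fun n => ?_) hlim
  set h : ℝ → G := fun t => F (X + t • Y) with hh
  have hsm : ContDiff ℝ (⊤ : ℕ∞) h := hF.comp (by fun_prop)
  have hw : ∀ k, ∀ y ∈ Set.Icc (0 : ℝ) 1, iteratedDerivWithin k h (Set.Icc 0 1) y =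
      iteratedFDeriv ℝ k F (X + y • Y) (fun _ => Y) := by
    intro k y hy
    rw [iteratedDerivWithin_eq_iteratedDeriv (uniqueDiffOn_Icc one_pos)
      (hsm.of_le (by exact_mod_cast le_top)).contDiffAt hy, iteratedDeriv_comp_add_smul hF]
  have key := taylor_mean_remainder_bound (f := h) (n := n) (C := M * (K * ‖Y‖) ^ (n + 1))
    (x := 1) zero_le_one (hsm.of_le (by exact_mod_cast le_top)).contDiffOn
    (Set.right_mem_Icc.2 zero_le_one) (fun y hy => by rw [hw _ y hy]; exact hle _ _)
  rw [taylor_within_apply, norm_sub_rev] at key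
  have h0 : (0 : ℝ) ∈ Set.Icc (0 : ℝ) 1 := Set.left_mem_Icc.2 zero_le_one
  simp only [hw _ _ h0, sub_zero, one_pow, mul_one, zero_smul, add_zero] at key
  simp only [hh, one_smul] at key
  exact key.trans_eq (by ring)

end Taylor

section Complexification

theorem Complex.smul_eq_re_add_im {U : Type*} [AddCommGroup U] [Module ℝ U] [Module ℂ U]
    [IsScalarTower ℝ ℂ U] (c : ℂ) (z : U) : c • z = c.re • z + c.im • Complex.I • z := by
  conv_lhs => rw [← Complex.re_add_im c]
  rw [add_smul, mul_smul, ← smul_assoc c.im, ← algebraMap_smul ℂ c.re z]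
  simp [mul_smul]

variable {V W : Type*} [NormedAddCommGroup V] [NormedSpace ℝ V]
  [NormedAddCommGroup W] [NormedSpace ℝ W] [NormedSpace ℂ W] [IsScalarTower ℝ ℂ W]

/-- An inclusion of the real normed space `V` into the complex normed space `W`, together with
compatible real and imaginary part projections. -/
structure RealForm (V W : Type*) [NormedAddCommGroup V] [NormedSpace ℝ V]
    [NormedAddCommGroup W] [NormedSpace ℝ W] [NormedSpace ℂ W] where
  /-- The inclusion of the real form. -/
  incl : V →L[ℝ] W
  /-- The real part. -/
  re : W →L[ℝ] V
  /-- The imaginary part. -/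
  im : W →L[ℝ] V
  re_incl : ∀ x, re (incl x) = x
  im_incl : ∀ x, im (incl x) = 0
  re_I_smul : ∀ z, re (Complex.I • z) = -im z
  im_I_smul : ∀ z, im (Complex.I • z) = re z

namespace RealForm

variable (R : RealForm V W) {E : Type*} [NormedAddCommGroup E] [NormedSpace ℝ E]
  [NormedSpace ℂ E] [IsScalarTower ℝ ℂ E]

/-- The complex-linear extension of a real-linear map defined on the real form. -/
def extend (L : V →L[ℝ] E) : W →L[ℂ] E :=
  LinearMap.mkContinuous
    { toFun := fun z => L (R.re z) + Complex.I • L (R.im z)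
      map_add' := fun z w => by simp only [map_add, smul_add]; abel
      map_smul' := fun c z => by
        have hI : ∀ z : W, L (R.re (Complex.I • z)) + Complex.I • L (R.im (Complex.I • z)) =
            Complex.I • (L (R.re z) + Complex.I • L (R.im z)) := fun z => by
          rw [R.re_I_smul, R.im_I_smul, smul_add, smul_smul, Complex.I_mul_I]
          simp [add_comm]
        rw [RingHom.id_apply, Complex.smul_eq_re_add_im c (L (R.re z) + _), ← hI,
          Complex.smul_eq_re_add_im c z]
        simp only [map_add, map_smul, smul_add, smul_comm Complex.I]
        abel }
    (‖L‖ * (‖R.re‖ + ‖R.im‖)) fun z => by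
      calc ‖L (R.re z) + Complex.I • L (R.im z)‖ ≤ ‖L (R.re z)‖ + ‖Complex.I • L (R.im z)‖ :=
            norm_add_le _ _
        _ ≤ ‖L‖ * (‖R.re‖ * ‖z‖) + ‖L‖ * (‖R.im‖ * ‖z‖) := by
          rw [norm_smul, Complex.norm_I, one_mul]
          gcongr
          · exact (L.le_opNorm _).trans (by gcongr; exact R.re.le_opNorm z)
          · exact (L.le_opNorm _).trans (by gcongr; exact R.im.le_opNorm z)
        _ = _ := by ring

theorem extend_apply (L : V →L[ℝ] E) (z : W) :
    R.extend L z = L (R.re z) + Complex.I • L (R.im z) := rfl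

theorem norm_extend_le (L : V →L[ℝ] E) : ‖R.extend L‖ ≤ ‖L‖ * (‖R.re‖ + ‖R.im‖) :=
  LinearMap.mkContinuous_norm_le _ (by positivity) _

theorem exists_complexify (m : ℕ) :
    ∃ C : (V [×m]→L[ℝ] ℂ) →L[ℝ] (W [×m]→L[ℂ] ℂ),
      (∀ f, ‖C f‖ ≤ (‖R.re‖ + ‖R.im‖) ^ m * ‖f‖) ∧
      ∀ f (v : Fin m → V), C f (fun j => R.incl (v j)) = f v := by
  induction m with
  | zero =>
    refine ⟨LinearMap.mkContinuous
      { toFun := fun f => ContinuousMultilinearMap.uncurry0 ℂ W (f 0)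
        map_add' := fun f g => by ext; simp
        map_smul' := fun c f => by ext; simp } 1 fun f => ?_, fun f => ?_, fun f v => ?_⟩
    · simp
    · simp
    · simp [Subsingleton.elim v 0]
  | succ m ih =>
    obtain ⟨C, hC, hCv⟩ := ih
    have hbound : ∀ f : V [×(m + 1)]→L[ℝ] ℂ,
        ‖(ContinuousLinearMap.uncurryLeft (Ei := fun _ : Fin (m + 1) => W)
          (R.extend (C.comp f.curryLeft)))‖ ≤
          (‖R.re‖ + ‖R.im‖) ^ (m + 1) * ‖f‖ := fun f => by
      rw [ContinuousLinearMap.uncurryLeft_norm (𝕜 := ℂ) (Ei := fun _ : Fin (m + 1) => W)]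
      have h1 : ‖C.comp f.curryLeft‖ ≤ (‖R.re‖ + ‖R.im‖) ^ m * ‖f‖ := by
        refine ContinuousLinearMap.opNorm_le_bound _ (by positivity) fun x => ?_
        refine (hC _).trans ?_
        rw [mul_assoc]
        gcongr
        rw [← f.curryLeft_norm]
        exact f.curryLeft.le_opNorm x
      calc _ ≤ _ := R.norm_extend_le _
        _ ≤ ((‖R.re‖ + ‖R.im‖) ^ m * ‖f‖) * (‖R.re‖ + ‖R.im‖) := by gcongr
        _ = _ := by ring
    refine ⟨LinearMap.mkContinuous
      { toFun := fun f => (ContinuousLinearMap.uncurryLeft (Ei := fun _ : Fin (m + 1) => W)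
          (R.extend (C.comp f.curryLeft)))
        map_add' := fun f g => ?_
        map_smul' := fun c f => ?_ } _ hbound, hbound, fun f v => ?_⟩
    · ext v
      have h : ∀ x, (f + g).curryLeft x = f.curryLeft x + g.curryLeft x := fun _ => rfl
      simp [extend_apply, h]
      exact add_add_add_comm _ _ _ _
    · ext v
      have h : ∀ x, (c • f).curryLeft x = c • f.curryLeft x := fun _ => rfl
      simp [extend_apply, h]
      exact mul_left_comm _ _ _
    · have h := hCv (f.curryLeft (v 0)) (Fin.tail v)
      simp only [LinearMap.mkContinuous_apply, LinearMap.coe_mk, AddHom.coe_mk,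
        ContinuousLinearMap.uncurryLeft_apply, extend_apply, R.re_incl, R.im_incl, map_zero,
        smul_zero, add_zero, ContinuousLinearMap.comp_apply]
      exact h.trans (by simp)

end RealForm

end Complexification

theorem iteratedDeriv_ofReal_eq {g : ℂ → ℂ} {h : ℝ → ℂ} (hg : Differentiable ℂ g)
    (hgh : ∀ t : ℝ, g t = h t) (n : ℕ) (t : ℝ) : iteratedDeriv n g t = iteratedDeriv n h t := by
  induction n generalizing t with
  | zero => simpa using hgh t
  | succ n ih =>
    have hd : DifferentiableAt ℂ (iteratedDeriv n g) t :=
      (hg.contDiff (n := ⊤)).differentiable_iteratedDeriv n (by simp) t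
    rw [iteratedDeriv_succ, iteratedDeriv_succ, ← hd.hasDerivAt.comp_ofReal.deriv]
    congr 1
    ext s
    exact ih s

theorem RealForm.exists_analytic_extension {V W : Type*} [NormedAddCommGroup V] [NormedSpace ℝ V]
    [NormedAddCommGroup W] [NormedSpace ℝ W] [NormedSpace ℂ W] [IsScalarTower ℝ ℂ W]
    (R : RealForm V W) {M K : ℝ} (hM : 0 ≤ M) (hK : 0 ≤ K) {F : V → ℂ}
    (hF : ContDiff ℝ (⊤ : ℕ∞) F)
    (hbd : ∀ (m : ℕ) (X : V) (v : Fin m → V),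
      ‖iteratedFDeriv ℝ m F X v‖ ≤ M * ∏ j, (K * ‖v j‖)) :
    ∃ 𝓕 : W → ℂ, (∀ z, AnalyticAt ℂ 𝓕 z) ∧ (∀ X, 𝓕 (R.incl X) = F X) ∧
      ∀ X Y, ‖𝓕 (R.incl X + Complex.I • R.incl Y)‖ ≤ M * Real.exp (K * ‖Y‖) := by
  choose C hC hCv using R.exists_complexify
  have hc : 0 ≤ ‖R.re‖ + ‖R.im‖ := by positivity
  generalize ‖R.re‖ + ‖R.im‖ = c at hC hc
  have hnorm : ∀ m, ‖iteratedFDeriv ℝ m F 0‖ ≤ M * K ^ m := fun m =>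
    ContinuousMultilinearMap.opNorm_le_bound (by positivity) fun v =>
      (hbd m 0 v).trans_eq (by simp [Finset.prod_mul_distrib, mul_assoc])
  let p : FormalMultilinearSeries ℂ W ℂ := fun m =>
    (m ! : ℂ)⁻¹ • C m (iteratedFDeriv ℝ m F 0)
  have hpn : ∀ m, ‖p m‖ ≤ M * ((c * K) ^ m / m !) := fun m => by
    have : ‖p m‖ = (m ! : ℝ)⁻¹ * ‖C m (iteratedFDeriv ℝ m F 0)‖ := by
      simp [p, norm_smul]
    rw [this]
    calc _ ≤ (m ! : ℝ)⁻¹ * (c ^ m * (M * K ^ m)) := by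
          gcongr
          exact (hC m _).trans (by gcongr; exact hnorm m)
      _ = _ := by ring
  have hrad : p.radius = ⊤ := by
    refine p.radius_eq_top_of_summable_norm fun r => ?_
    refine Summable.of_nonneg_of_le (fun _ => by positivity) (fun m => ?_)
      ((Real.summable_pow_div_factorial (c * K * r)).mul_left M)
    calc ‖p m‖ * (r : ℝ) ^ m ≤ M * ((c * K) ^ m / m !) * r ^ m := by gcongr; exact hpn m
      _ = _ := by ring
  have hball := p.hasFPowerSeriesOnBall (by simp [hrad])
  rw [hrad] at hball
  have han : ∀ z, AnalyticAt ℂ p.sum z := fun z => hball.analyticAt_of_mem (by simp)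
  have hext : ∀ X, p.sum (R.incl X) = F X := fun X => by
    have h1 := hasSum_taylor_of_iteratedFDeriv_le hF hbd 0 X
    rw [zero_add] at h1
    rw [← h1.tsum_eq, FormalMultilinearSeries.sum]
    congr 1
    ext m
    simp [p, hCv m _ (fun _ => X)]
  refine ⟨p.sum, han, hext, fun X Y => ?_⟩
  let g : ℂ → ℂ := fun z => p.sum (R.incl X + z • R.incl Y)
  have hg : Differentiable ℂ g := fun z =>
    (han _).differentiableAt.comp z (by fun_prop)
  have hgh : ∀ t : ℝ, g t = F (X + t • Y) := fun t => by
    rw [← hext, map_add, map_smul, ← algebraMap_smul ℂ t (R.incl Y)]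
    rfl
  have hs := Complex.hasSum_taylorSeries_of_entire hg 0 Complex.I
  have hexp : HasSum (fun n : ℕ => M * ((K * ‖Y‖) ^ n / n !)) (M * Real.exp (K * ‖Y‖)) := by
    rw [Real.exp_eq_exp_ℝ]
    exact (NormedSpace.expSeries_div_hasSum_exp (K * ‖Y‖)).mul_left M
  change ‖g Complex.I‖ ≤ _
  refine hs.norm_le_of_bounded hexp fun n => ?_
  have hn : iteratedDeriv n g 0 = iteratedFDeriv ℝ n F X (fun _ => Y) := by
    have := iteratedDeriv_ofReal_eq hg hgh n 0
    rw [iteratedDeriv_comp_add_smul hF] at this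
    simpa using this
  have hb := hbd n X (fun _ => Y)
  rw [Finset.prod_const, Finset.card_univ, Fintype.card_fin] at hb
  rw [hn, norm_smul, norm_smul, sub_zero, norm_pow, Complex.norm_I, one_pow, one_mul, norm_inv,
    Complex.norm_natCast]
  calc (n ! : ℝ)⁻¹ * _ ≤ (n ! : ℝ)⁻¹ * (M * (K * ‖Y‖) ^ n) := by gcongr
    _ = _ := by ring

/-- Apply a real-linear functional `ℂ → ℝ` to each coordinate. -/
def coordMap (ℓ : ℂ →L[ℝ] ℝ) : EuclideanSpace ℂ (Fin 3) →L[ℝ] EuclideanSpace ℂ (Fin 3) :=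
  LinearMap.toContinuousLinearMap
    { toFun := fun v => WithLp.toLp 2 fun i => (ℓ (v i) : ℂ)
      map_add' := fun v w => by ext i; simp
      map_smul' := fun c v => by
        ext i
        change ((ℓ (c • v i) : ℝ) : ℂ) = c • (ℓ (v i) : ℂ)
        rw [map_smul]
        simp }

@[simp]
theorem coordMap_apply (ℓ : ℂ →L[ℝ] ℝ) (v : EuclideanSpace ℂ (Fin 3)) (i : Fin 3) :
    coordMap ℓ v i = (ℓ (v i) : ℂ) := rfl

/-- Apply a real-linear functional `ℂ → ℝ` to each coordinate of a vector field. -/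
def fieldMap (ℓ : ℂ →L[ℝ] ℝ) : WC →L[ℝ] WC :=
  (coordMap ℓ).compLpL 2 volume

theorem fieldMap_ae (ℓ : ℂ →L[ℝ] ℝ) (Z : WC) :
    ∀ᵐ k : K3, ∀ i, fieldMap ℓ Z k i = (ℓ (Z k i) : ℂ) := by
  filter_upwards [(coordMap ℓ).coeFn_compLpL (p := 2) (μ := volume) Z] with k hk i
  rw [fieldMap, hk, coordMap_apply]

theorem fieldMap_re_of_real {Z : WC} (hZ : ∀ᵐ k : K3, ∀ i, (Z k i).im = 0) :
    fieldMap Complex.reCLM Z = Z := by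
  refine Lp.ext ?_
  filter_upwards [fieldMap_ae Complex.reCLM Z, hZ] with k h1 h2
  ext i
  rw [h1]
  apply Complex.ext <;> simp [h2 i]

theorem fieldMap_im_of_real {Z : WC} (hZ : ∀ᵐ k : K3, ∀ i, (Z k i).im = 0) :
    fieldMap Complex.imCLM Z = 0 := by
  refine Lp.ext ?_
  filter_upwards [fieldMap_ae Complex.imCLM Z, hZ, Lp.coeFn_zero (EuclideanSpace ℂ (Fin 3)) 2
    (volume : Measure K3)] with k h1 h2 h3
  ext i
  rw [h1, h3]
  simp [h2 i]

theorem fieldMap_re_I_smul (Z : WC) :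
    fieldMap Complex.reCLM (Complex.I • Z) = -fieldMap Complex.imCLM Z := by
  refine Lp.ext ?_
  filter_upwards [fieldMap_ae Complex.reCLM (Complex.I • Z), fieldMap_ae Complex.imCLM Z,
    Lp.coeFn_smul Complex.I Z, Lp.coeFn_neg (fieldMap Complex.imCLM Z)] with k h1 h2 h3 h4
  ext i
  rw [h1, h3, h4]
  simp [h2 i]

theorem fieldMap_im_I_smul (Z : WC) :
    fieldMap Complex.imCLM (Complex.I • Z) = fieldMap Complex.reCLM Z := by
  refine Lp.ext ?_
  filter_upwards [fieldMap_ae Complex.imCLM (Complex.I • Z), fieldMap_ae Complex.reCLM Z,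
    Lp.coeFn_smul Complex.I Z] with k h1 h2 h3
  ext i
  rw [h1, h2, h3]
  simp

theorem fieldMap_re_add_I_smul_im (Z : WC) :
    Z = fieldMap Complex.reCLM Z + Complex.I • fieldMap Complex.imCLM Z := by
  refine Lp.ext ?_
  filter_upwards [fieldMap_ae Complex.reCLM Z, fieldMap_ae Complex.imCLM Z,
    Lp.coeFn_add (fieldMap Complex.reCLM Z) (Complex.I • fieldMap Complex.imCLM Z),
    Lp.coeFn_smul Complex.I (fieldMap Complex.imCLM Z)] with k h1 h2 h3 h4
  ext i
  rw [h3, Pi.add_apply, h4]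
  simp only [PiLp.add_apply, Pi.smul_apply, PiLp.smul_apply, h1 i, h2 i, smul_eq_mul]
  simp [mul_comm Complex.I, Complex.re_add_im]

/-- Apply a real-linear functional `ℂ → ℝ` to each coordinate of a pair of vector fields. -/
def pairMap (ℓ : ℂ →L[ℝ] ℝ) : WC × WC →L[ℝ] Vsub :=
  ((fieldMap ℓ).prodMap (fieldMap ℓ)).codRestrict Vsub fun Z => by
    constructor
    · filter_upwards [fieldMap_ae ℓ Z.1] with k hk i
      exact (congrArg Complex.im (hk i)).trans (Complex.ofReal_im _)
    · filter_upwards [fieldMap_ae ℓ Z.2] with k hk i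
      exact (congrArg Complex.im (hk i)).trans (Complex.ofReal_im _)

theorem coe_pairMap (ℓ : ℂ →L[ℝ] ℝ) (Z : WC × WC) :
    (pairMap ℓ Z : WC × WC) = (fieldMap ℓ Z.1, fieldMap ℓ Z.2) := rfl

/-- The space of pairs of real-valued fields as a real form of the complex Hilbert space of pairs
of fields. -/
def pairRealForm : RealForm Vsub (WC × WC) where
  incl := Vsub.subtypeL
  re := pairMap Complex.reCLM
  im := pairMap Complex.imCLM
  re_incl X := Subtype.ext <|
    Prod.ext (fieldMap_re_of_real X.2.1) (fieldMap_re_of_real X.2.2)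
  im_incl X := Subtype.ext <|
    Prod.ext (fieldMap_im_of_real X.2.1) (fieldMap_im_of_real X.2.2)
  re_I_smul Z := Subtype.ext <| Prod.ext (fieldMap_re_I_smul Z.1) (fieldMap_re_I_smul Z.2)
  im_I_smul Z := Subtype.ext <| Prod.ext (fieldMap_im_I_smul Z.1) (fieldMap_im_I_smul Z.2)

theorem pairRealForm_re_add_I_smul_im (Z : WC × WC) :
    Z = (pairRealForm.re Z : WC × WC) + Complex.I • (pairRealForm.im Z : WC × WC) :=
  Prod.ext (fieldMap_re_add_I_smul_im Z.1) (fieldMap_re_add_I_smul_im Z.2)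

theorem RealForm.re_im_incl_add_I_smul_incl {V W : Type*} [NormedAddCommGroup V]
    [NormedSpace ℝ V] [NormedAddCommGroup W] [NormedSpace ℝ W] [NormedSpace ℂ W]
    (R : RealForm V W) (X Y : V) :
    R.re (R.incl X + Complex.I • R.incl Y) = X ∧ R.im (R.incl X + Complex.I • R.incl Y) = Y := by
  simp [R.re_incl, R.im_incl, R.re_I_smul, R.im_I_smul]

/-- Every `Z ∈ 𝓦` decomposes uniquely as `X + iY` with `X, Y ∈ 𝓥`, and
every smooth `F : 𝓥 → ℂ` whose `m`-th Fréchet derivatives satisfy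
`|d^m F(X)(X₁,…,X_m)| ≤ M ∏ K|X_j|` extends to an analytic function `𝓕` on `𝓦` with
`|𝓕(X+iY)| ≤ M e^{K|Y|}` for `X, Y ∈ 𝓥`. -/
theorem stmt_16 (M K : ℝ) (hM : 0 ≤ M) (hK : 0 ≤ K)
    (F : Vsub → ℂ) (hFsmooth : ContDiff ℝ (⊤ : ℕ∞) F)
    (hFder : ∀ (m : ℕ) (X : Vsub) (v : Fin m → Vsub),
      ‖iteratedFDeriv ℝ m F X v‖ ≤ M * ∏ j, (K * ‖v j‖)) :
    (∀ Z : WC × WC, ∃! P : Vsub × Vsub,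
      Z = (P.1 : WC × WC) + Complex.I • (P.2 : WC × WC)) ∧
    ∃ 𝓕 : WC × WC → ℂ,
      (∀ z : WC × WC, AnalyticAt ℂ 𝓕 z) ∧
      (∀ X : Vsub, 𝓕 X = F X) ∧
      (∀ X Y : Vsub,
        ‖𝓕 ((X : WC × WC) + Complex.I • (Y : WC × WC))‖ ≤ M * Real.exp (K * ‖Y‖)) := by
  refine ⟨fun Z => ⟨(pairRealForm.re Z, pairRealForm.im Z), pairRealForm_re_add_I_smul_im Z, ?_⟩,
    pairRealForm.exists_analytic_extension hM hK hFsmooth hFder⟩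
  rintro ⟨X, Y⟩ rfl
  have h := pairRealForm.re_im_incl_add_I_smul_incl X Y
  exact Prod.ext h.1.symm h.2.symm
end
end
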